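/- arXiv:1701.08121 — 5 statements merged into one kernel-verified Lean document; each statement's English description precedes it below -/
import Mathlib

section
/- Let w₁, …, w_m ∈ F₂ be nontrivial words. Then there exists a nontrivial word w ∈ F₂ of length at most 16 m² · max_i |w_i| such that for every group G, the vanishing set Z(G,w) contains Z(G,w₁) ∪ … ∪ Z(G,w_m). -/
namespace FreeGroup

theorem subsingleton_of_commute_of {α : Type*} {z : FreeGroup α} (hz : z ≠ 1)
    (h : ∀ j, Commute z (of j)) : Subsingleton α := by
  classical
  obtain ⟨⟨k, e⟩, L, hL⟩ := List.exists_cons_of_ne_nil (mt toWord_eq_nil_iff.1 hz)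
  have key : ∀ j, j = k := by
    intro j
    by_contra hj
    have h1 : (of j * z).toWord = (j, true) :: (k, e) :: L := by
      have hr : reduce ((k, e) :: L) = (k, e) :: L := by rw [← hL, reduce_toWord]
      rw [toWord_mul, toWord_of, hL, List.singleton_append, reduce.cons, hr]
      simp [hj]
    have h2 := toWord_mul_sublist z (of j)
    rw [(h j).eq, h1, hL, toWord_of] at h2
    have h3 := h2.eq_of_length (by simp)
    simp only [List.cons_append, List.cons.injEq, Prod.mk.injEq] at h3
    exact hj h3.1.1
  exact ⟨fun i j => (key i).trans (key j).symm⟩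

theorem isCyclic_of_subsingleton (α : Type*) [Subsingleton α] : IsCyclic (FreeGroup α) := by
  rcases isEmpty_or_nonempty α with _ | ⟨⟨k⟩⟩
  · infer_instance
  · rw [isCyclic_iff_exists_zpowers_eq_top]
    refine ⟨of k, ?_⟩
    rw [Subgroup.zpowers_eq_closure, ← closure_range_of]
    congr 1
    ext x
    constructor
    · rintro rfl
      exact ⟨k, rfl⟩
    · rintro ⟨j, rfl⟩
      rw [Subsingleton.elim j k]
      rfl

/-- Centralizers of nontrivial elements of a free group are cyclic. -/
theorem exists_zpow_of_commute {α : Type*} {a : FreeGroup α} (ha : a ≠ 1) :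
    ∃ c, Commute a c ∧ ∀ b, Commute a b → ∃ n : ℤ, c ^ n = b := by
  let C := Subgroup.centralizer {a}
  have mem : ∀ {b}, b ∈ C ↔ Commute a b := fun {b} => by
    rw [Subgroup.mem_centralizer_singleton_iff]
    exact eq_comm
  let a' : C := ⟨a, mem.2 (Commute.refl a)⟩
  have ha' : a' ≠ 1 := fun h => ha (congrArg Subtype.val h)
  let e : C ≃* FreeGroup (IsFreeGroup.Generators C) := IsFreeGroup.toFreeGroup C
  have := subsingleton_of_commute_of (z := e a') (by simpa using ha') (fun j => by
    have : Commute a' (e.symm (of j)) := Subtype.ext (mem.1 (e.symm (of j)).2)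
    simpa using this.map e)
  have := isCyclic_of_subsingleton (IsFreeGroup.Generators C)
  have : IsCyclic C := isCyclic_of_surjective e.symm e.symm.surjective
  obtain ⟨c, hc⟩ := IsCyclic.exists_generator (α := C)
  refine ⟨c, mem.1 c.2, fun b hb => ?_⟩
  obtain ⟨n, hn⟩ := hc ⟨b, mem.2 hb⟩
  exact ⟨n, by simpa using congrArg Subtype.val hn⟩

/-- Commutation is transitive on nontrivial elements of a free group. -/
theorem commute_trans {α : Type*} {a b c : FreeGroup α} (ha : a ≠ 1)
    (hb : Commute a b) (hc : Commute a c) : Commute b c := by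
  obtain ⟨d, -, hd⟩ := exists_zpow_of_commute ha
  obtain ⟨m, rfl⟩ := hd b hb
  obtain ⟨n, rfl⟩ := hd c hc
  exact (Commute.refl d).zpow_zpow m n

theorem commute_of_commute_conj {α : Type*} {b s : FreeGroup α} (hb : b ≠ 1)
    (h : Commute b (s * b * s⁻¹)) : Commute b s := by
  rcases eq_or_ne s 1 with rfl | hs
  · exact Commute.one_right b
  obtain ⟨c, hbc, hc⟩ := exists_zpow_of_commute hb
  have hc1 : c ≠ 1 := by
    rintro rfl
    obtain ⟨n, hn⟩ := hc b (Commute.refl b)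
    exact hb (by simpa using hn.symm)
  have hb' : s * b * s⁻¹ ≠ 1 := by simpa using hb
  have h1 : Commute (s * b * s⁻¹) (s * c * s⁻¹) := by
    simpa [MulAut.conj_apply] using hbc.map (MulAut.conj s)
  obtain ⟨l, hl⟩ := hc _ (commute_trans hb' h.symm h1)
  have h2 : Commute b (s⁻¹ * c * s) := by
    simpa [MulAut.conj_apply, mul_assoc] using
      (commute_trans hb h hbc).map (MulAut.conj s⁻¹)
  obtain ⟨k, hk⟩ := hc _ h2
  have hlk : l * k = 1 := by
    rw [← sub_eq_zero, ← IsMulTorsionFree.zpow_eq_one_iff_right hc1, zpow_sub_one, mul_inv_eq_one,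
      zpow_mul, hl, conj_zpow, hk]
    group
  have hl1 : l * l = 1 := by
    rcases Int.eq_one_or_neg_one_of_mul_eq_one hlk with h | h <;> simp [h]
  have h3 : Commute (s ^ 2) c := by
    have : s * (s * c * s⁻¹) * s⁻¹ = c := by
      conv_lhs => rw [← hl, ← conj_zpow, ← hl, ← zpow_mul, hl1, zpow_one]
    rw [Commute, SemiconjBy, pow_two]
    conv_rhs => rw [← this]
    group
  have hs2 : s ^ 2 ≠ 1 := by
    simpa using hs
  exact commute_trans hc1 hbc.symm
    (commute_trans hs2 h3 ((Commute.refl s).pow_left 2))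

theorem exists_not_commute_conj {α : Type*} [DecidableEq α] [Nontrivial α]
    {a b : FreeGroup α} (ha : a ≠ 1) (hb : b ≠ 1) :
    ∃ s : FreeGroup α, s.norm ≤ 1 ∧ ¬ Commute a (s * b * s⁻¹) := by
  by_contra! h
  have hab : Commute a b := by simpa using h 1 (by simp)
  have := subsingleton_of_commute_of hb fun j =>
    commute_of_commute_conj hb (commute_trans ha hab (h (of j) (by simp)))
  exact not_subsingleton α this

open Subgroup commutatorElement in
theorem exists_short_mem_normalClosure {α : Type*} [DecidableEq α] [Nontrivial α]
    (L k : ℕ) (S : ℕ → FreeGroup α) (hS : ∀ i, S i ≠ 1) (hL : ∀ i, (S i).norm ≤ L) :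
    ∃ W : FreeGroup α, W ≠ 1 ∧ 3 * W.norm + 4 ≤ 4 ^ k * (3 * L + 4) ∧
      ∀ i < 2 ^ k, W ∈ normalClosure {S i} := by
  induction k generalizing S with
  | zero =>
    refine ⟨S 0, hS 0, by simpa using hL 0, fun i hi => ?_⟩
    obtain rfl : i = 0 := by simpa using hi
    exact subset_normalClosure rfl
  | succ k ih =>
    obtain ⟨A, hA, hAL, hAS⟩ := ih S hS hL
    obtain ⟨B, hB, hBL, hBS⟩ := ih (fun i => S (i + 2 ^ k)) (fun i => hS _) (fun i => hL _)
    obtain ⟨s, hs, hAB⟩ := exists_not_commute_conj hA hB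
    refine ⟨⁅A, s * B * s⁻¹⁆, mt commutatorElement_eq_one_iff_commute.1 hAB, ?_, fun i hi => ?_⟩
    · have h1 : (s * B * s⁻¹).norm ≤ B.norm + 2 := by
        have := norm_mul_le (s * B) s⁻¹
        have := norm_mul_le s B
        have := norm_inv_eq (x := s)
        lia
      have h2 : (⁅A, s * B * s⁻¹⁆).norm ≤ 2 * A.norm + 2 * (s * B * s⁻¹).norm := by
        rw [commutatorElement_def]
        generalize s * B * s⁻¹ = D
        have := norm_mul_le (A * D * A⁻¹) D⁻¹
        have := norm_mul_le (A * D) A⁻¹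
        have := norm_mul_le A D
        have := norm_inv_eq (x := A)
        have := norm_inv_eq (x := D)
        lia
      rw [pow_succ]
      linarith
    · by_cases hik : i < 2 ^ k
      · exact commutator_le_left _ ⊤ (commutator_mem_commutator (hAS i hik) (mem_top _))
      · have h := hBS (i - 2 ^ k) (by rw [pow_succ] at hi; lia)
        rw [Nat.sub_add_cancel (not_lt.1 hik)] at h
        exact commutator_le_right ⊤ _
          (commutator_mem_commutator (mem_top _) (normalClosure_normal.conj_mem _ h s))

end FreeGroup

theorem statement2 (m : ℕ) (hm : 0 < m) (w : Fin m → FreeGroup (Fin 2))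
    (hw : ∀ i, w i ≠ 1) :
    ∃ W : FreeGroup (Fin 2), W ≠ 1 ∧
      W.toWord.length ≤ 16 * m ^ 2 * Finset.univ.sup (fun i => (w i).toWord.length) ∧
      ∀ (G : Type) [Group G] (g h : G),
        (∃ i, FreeGroup.lift ![g, h] (w i) = 1) → FreeGroup.lift ![g, h] W = 1 := by
  set L := Finset.univ.sup (fun i => (w i).toWord.length)
  have hL (i : Fin m) : (w i).norm ≤ L :=
    Finset.le_sup (f := fun i => (w i).toWord.length) (Finset.mem_univ i)
  have hL1 : 1 ≤ L :=
    (Nat.one_le_iff_ne_zero.2 (mt FreeGroup.norm_eq_zero.1 (hw ⟨0, hm⟩))).trans (hL ⟨0, hm⟩)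
  obtain ⟨k, hmk, hkm⟩ : ∃ k, m ≤ 2 ^ k ∧ 2 ^ k ≤ 2 * m := by
    refine ⟨Nat.log 2 m + 1, (Nat.lt_pow_succ_log_self one_lt_two m).le, ?_⟩
    have := Nat.pow_log_le_self 2 hm.ne'
    rw [pow_succ]
    lia
  obtain ⟨W, hW1, hWL, hW⟩ := FreeGroup.exists_short_mem_normalClosure L k
    (fun i => if h : i < m then w ⟨i, h⟩ else w ⟨0, hm⟩)
    (fun i => by split <;> exact hw _) (fun i => by split <;> exact hL _)
  refine ⟨W, hW1, ?_, ?_⟩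
  · have h4 : 4 ^ k ≤ 4 * m ^ 2 := by
      calc 4 ^ k = (2 ^ k) ^ 2 := by rw [← pow_mul, mul_comm, pow_mul]; norm_num
        _ ≤ (2 * m) ^ 2 := Nat.pow_le_pow_left hkm 2
        _ = 4 * m ^ 2 := by ring
    have h5 : 4 ^ k * (3 * L + 4) ≤ 4 * m ^ 2 * (7 * L) := Nat.mul_le_mul h4 (by lia)
    change W.norm ≤ _
    nlinarith
  · rintro G _ g h ⟨i, hi⟩
    have hWi := hW i (i.2.trans_le hmk)
    simp only [i.2, dif_pos] at hWi
    exact Subgroup.normalClosure_le_normal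
      (N := (FreeGroup.lift ![g, h]).ker) (Set.singleton_subset_iff.2 hi) hWi
end

section
/- Let 1 → N → G → Q → 1 be a short exact sequence of groups (i.e. N is isomorphic to a normal subgroup of G with quotient isomorphic to Q). Suppose N satisfies a nontrivial law in F₂ of length n_N and Q satisfies a nontrivial law in F₂ of length n_Q. Then G satisfies a nontrivial law in F₂ of length at most n_N · n_Q. -/
/-- `w` is a law for `G` if the image of `w` under every homomorphism `F₂ → G` is trivial. -/
def IsLaw (G : Type*) [Group G] (w : FreeGroup (Fin 2)) : Prop :=
  ∀ f : FreeGroup (Fin 2) →* G, f w = 1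

namespace FreeGroup

variable {α β : Type*}

/-- The word substituted for a signed letter when the generator `a` is replaced by `h a`. -/
def substLetter (h : α → List (β × Bool)) (p : α × Bool) : List (β × Bool) :=
  cond p.2 (h p.1) (invRev (h p.1))

theorem mk_flatMap_substLetter (h : α → List (β × Bool)) (L : List (α × Bool)) :
    mk (L.flatMap (substLetter h)) = lift (fun a => mk (h a)) (mk L) := by
  rw [lift_mk]
  induction L with
  | nil => rfl
  | cons p L ih =>
    rw [List.flatMap_cons, ← mul_mk, ih, List.map_cons, List.prod_cons]
    obtain ⟨a, _ | _⟩ := p <;> simp [substLetter, inv_mk]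

theorem invRev_substLetter (h : α → List (β × Bool)) (p : α × Bool) :
    invRev (substLetter h p) = substLetter h (p.1, !p.2) := by
  obtain ⟨a, _ | _⟩ := p <;> simp [substLetter]

theorem head?_invRev (L : List (β × Bool)) :
    (invRev L).head? = L.getLast?.map fun p => (p.1, !p.2) := by
  simp [invRev]

theorem IsReduced.invRev [DecidableEq β] {L : List (β × Bool)} (hL : IsReduced L) :
    IsReduced (invRev L) := by
  rw [isReduced_iff_reduce_eq] at hL ⊢
  rw [reduce_invRev, hL]

/-- Substituting reduced words for the generators creates no cancellation when these words and
their inverses start with pairwise distinct letters. -/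
theorem IsReduced.flatMap_substLetter [DecidableEq β] {h : α → List (β × Bool)}
    (hred : ∀ a, IsReduced (h a)) (hne : ∀ a, h a ≠ [])
    (hhead : ∀ p q, (substLetter h p).head? = (substLetter h q).head? → p = q)
    {L : List (α × Bool)} (hL : IsReduced L) : IsReduced (L.flatMap (substLetter h)) := by
  have hne' : ∀ p, substLetter h p ≠ [] := by
    rintro ⟨a, _ | _⟩
    · intro h0
      have := congrArg List.length h0
      simp [substLetter, hne] at this
    · exact hne a
  rw [IsReduced, List.flatMap, List.isChain_flatten
    (by simpa using fun a => ⟨fun _ => hne' (a, false), fun _ => hne' (a, true)⟩)]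
  constructor
  · simp only [List.mem_map]
    rintro _ ⟨⟨a, _ | _⟩, -, rfl⟩
    · exact (hred a).invRev
    · exact hred a
  · refine List.isChain_map_of_isChain _ ?_ hL
    intro p q hpq x hx y hy hxy
    by_contra hxy'
    have hy' : y = (x.1, !x.2) := by
      ext
      · exact hxy.symm
      · simpa using Bool.eq_not_of_ne (Ne.symm hxy')
    have := hhead (p.1, !p.2) q <| by
      rw [← invRev_substLetter, head?_invRev, Option.mem_def.1 hx, Option.mem_def.1 hy, hy']
      rfl
    subst this
    simpa using hpq rfl

/-- The signed permutation of the letters of `F₂` shifting the generators by `d` and inverting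
them when `c` holds. -/
def signedShift (d : Fin 2) (c : Bool) (p : Fin 2 × Bool) : Fin 2 × Bool :=
  (p.1 + d, p.2 ^^ c)

theorem invRev_map_signedShift (d : Fin 2) (c : Bool) (L : List (Fin 2 × Bool)) :
    invRev (L.map (signedShift d c)) = (invRev L).map (signedShift d c) := by
  simp [invRev, signedShift, Function.comp_def]

theorem IsReduced.map_signedShift (d : Fin 2) (c : Bool) {L : List (Fin 2 × Bool)}
    (hL : IsReduced L) : IsReduced (L.map (signedShift d c)) :=
  List.isChain_map_of_isChain _ (fun p q h => by simpa [signedShift] using h) hL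

theorem mk_map_signedShift (d : Fin 2) (c : Bool) (L : List (Fin 2 × Bool)) :
    mk (L.map (signedShift d c)) = lift (fun i => mk [(i + d, !c)]) (mk L) := by
  rw [← mk_flatMap_substLetter, List.map_eq_flatMap]
  congr 2
  funext ⟨i, b⟩
  cases b <;> simp [signedShift, substLetter, invRev]

theorem exists_signedShift_nodup :
    ∀ a b : Fin 2 × Bool, a ≠ b →
      ∃ d c, [a, b, signedShift d c a, signedShift d c b].Nodup := by
  decide

/-- A nonempty cyclically reduced word of `F₂` and one of its images under a signed permutation of
the letters can be substituted for the generators without cancellation. -/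
theorem IsCyclicallyReduced.exists_substLetter_isReduced {L : List (Fin 2 × Bool)}
    (hL : IsCyclicallyReduced L) (hne : L ≠ []) :
    ∃ d c, ∀ w : List (Fin 2 × Bool), IsReduced w →
      IsReduced (w.flatMap (substLetter ![L, L.map (signedShift d c)])) := by
  obtain ⟨a, ha⟩ : ∃ a, L.head? = some a := ⟨_, List.head?_eq_some_head hne⟩
  obtain ⟨z, hz⟩ : ∃ z, L.getLast? = some z := ⟨_, List.getLast?_eq_some_getLast hne⟩
  have haz : a ≠ (z.1, !z.2) := by
    rintro rfl
    simpa using hL.2 z hz _ ha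
  obtain ⟨d, c, hdc⟩ := exists_signedShift_nodup _ _ haz
  refine ⟨d, c, fun w hw => hw.flatMap_substLetter ?_ ?_ ?_⟩
  · rw [Fin.forall_fin_two]
    exact ⟨hL.isReduced, hL.isReduced.map_signedShift d c⟩
  · rw [Fin.forall_fin_two]
    exact ⟨hne, by simpa using hne⟩
  · have hi : (invRev L).head? = some (z.1, !z.2) := by rw [head?_invRev, hz]; rfl
    simp only [List.nodup_cons, List.mem_cons, List.not_mem_nil, not_or, or_false] at hdc
    rintro ⟨i, b⟩ ⟨j, b'⟩
    fin_cases i <;> fin_cases j <;> cases b <;> cases b' <;>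
      simp [substLetter, invRev_map_signedShift, ha, hi] <;> grind

end FreeGroup

open FreeGroup

namespace IsLaw

variable {G : Type*} [Group G] {w : FreeGroup (Fin 2)}

theorem map (hw : IsLaw G w) (e : FreeGroup (Fin 2) →* FreeGroup (Fin 2)) : IsLaw G (e w) :=
  fun f => hw (f.comp e)

theorem of_conj {c : FreeGroup (Fin 2)} (hw : IsLaw G (c * w * c⁻¹)) : IsLaw G w := fun f => by
  simpa using hw f

/-- Substituting laws for `G ⧸ N` into a law for `N` gives a law for `G`. -/
theorem lift_of_quotient {N : Subgroup G} [N.Normal] (hw : IsLaw N w)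
    {u : Fin 2 → FreeGroup (Fin 2)} (hu : ∀ i, IsLaw (G ⧸ N) (u i)) : IsLaw G (lift u w) := by
  intro f
  have hmem : ∀ i, f (u i) ∈ N := fun i =>
    (QuotientGroup.eq_one_iff _).1 (hu i ((QuotientGroup.mk' N).comp f))
  have heq : f.comp (lift u) = N.subtype.comp (lift fun i => ⟨f (u i), hmem i⟩) := by
    ext i
    simp
  rw [← MonoidHom.comp_apply, heq, MonoidHom.comp_apply, hw, _root_.map_one]

end IsLaw

theorem statement3 (G : Type) [Group G] (N : Subgroup G) [N.Normal]
    (wN wQ : FreeGroup (Fin 2)) (hwN : wN ≠ 1) (hwQ : wQ ≠ 1)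
    (hlawN : IsLaw N wN) (hlawQ : IsLaw (G ⧸ N) wQ) :
    ∃ w : FreeGroup (Fin 2), w ≠ 1 ∧
      w.toWord.length ≤ wN.toWord.length * wQ.toWord.length ∧ IsLaw G w := by
  set L := reduceCyclically wQ.toWord with hLdef
  have hconj := reduceCyclically.conj_conjugator_reduceCyclically wQ.toWord
  rw [← hLdef] at hconj
  have hwQ_eq : wQ = mk (reduceCyclically.conjugator wQ.toWord) * mk L *
      (mk (reduceCyclically.conjugator wQ.toWord))⁻¹ := by
    rw [inv_mk, mul_mk, mul_mk, hconj, mk_toWord]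
  have hLne : L ≠ [] := by
    intro h
    apply hwQ
    rw [hwQ_eq, h, ← one_eq_mk, mul_one, mul_inv_cancel]
  have hLlen : L.length ≤ wQ.toWord.length := by
    have := congrArg List.length hconj
    simp only [List.length_append] at this
    omega
  have hLlaw : IsLaw (G ⧸ N) (mk L) := IsLaw.of_conj (hwQ_eq ▸ hlawQ)
  obtain ⟨d, c, hsubst⟩ :=
    (reduceCyclically.isCyclicallyReduced isReduced_toWord).exists_substLetter_isReduced hLne
  rw [← hLdef] at hsubst
  have hlen : ∀ p, (substLetter ![L, L.map (signedShift d c)] p).length = L.length := by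
    rintro ⟨i, b⟩
    fin_cases i <;> cases b <;> simp [substLetter]
  have hword := (hsubst _ (isReduced_toWord (x := wN))).reduce_eq
  have hlength : (wN.toWord.flatMap (substLetter ![L, L.map (signedShift d c)])).length =
      wN.toWord.length * L.length := by
    simp [List.length_flatMap, hlen]
  refine ⟨mk (wN.toWord.flatMap (substLetter ![L, L.map (signedShift d c)])), ?_, ?_, ?_⟩
  · rw [Ne, ← toWord_eq_nil_iff, toWord_mk, hword, ← List.length_eq_zero_iff, hlength]
    simp [hwN, hLne]
  · rw [toWord_mk, hword, hlength]
    exact Nat.mul_le_mul_left _ hLlen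
  · rw [mk_flatMap_substLetter, mk_toWord]
    refine hlawN.lift_of_quotient ?_
    rw [Fin.forall_fin_two]
    refine ⟨hLlaw, ?_⟩
    change IsLaw (G ⧸ N) (mk (L.map (signedShift d c)))
    rw [mk_map_signedShift]
    exact hLlaw.map _
end

section
/- Let Γ₁ and Γ₂ be free groups of finite ranks k₁, k₂ ≥ 2, with finite generating sets S₁ and S₂ respectively. Then F_{Γ₁}^{S₁} ≃ F_{Γ₂}^{S₂}, i.e. their residual finiteness growth functions are equivalent under the preorder ≼. -/
/-- `k_Γ(g)`: the minimal order of a finite group `Q` admitting a homomorphism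
`π : Γ → Q` with `π g ≠ 1`. -/
noncomputable def kGamma {Γ : Type} [Group Γ] (g : Γ) : ℕ :=
  sInf {m : ℕ | ∃ (Q : Type) (_ : Group Q) (_ : Fintype Q) (π : Γ →* Q),
    π g ≠ 1 ∧ Nat.card Q = m}

/-- `g` lies in the ball of radius `n` in the word metric associated to `S`. -/
def inBall {Γ : Type} [Group Γ] (S : Finset Γ) (n : ℕ) (g : Γ) : Prop :=
  ∃ l : List Γ, l.length ≤ n ∧ (∀ a ∈ l, a ∈ S ∨ a⁻¹ ∈ S) ∧ l.prod = g

/-- The residual finiteness growth function `F_Γ^S(n)`: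
the maximum of `k_Γ(g)` over nontrivial `g` in the ball of radius `n`. -/
noncomputable def rfGrowth {Γ : Type} [Group Γ] (S : Finset Γ) (n : ℕ) : ℕ :=
  sSup {m : ℕ | ∃ g : Γ, g ≠ 1 ∧ inBall S n g ∧ kGamma g = m}

/-- `f₁ ≼ f₂`: there is `C > 0` with `f₁(n) ≤ C · f₂(C·n)` for all positive `n`. -/
def Preceq (f₁ f₂ : ℕ → ℝ) : Prop :=
  ∃ C : ℝ, 0 < C ∧ ∀ n : ℕ, 0 < n → f₁ n ≤ C * f₂ ⌈C * (n : ℝ)⌉₊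

/-- A word metric ball of a finite set is finite. -/
theorem finite_setOf_inBall {Γ : Type} [Group Γ] (S : Finset Γ) (n : ℕ) :
    {g : Γ | inBall S n g}.Finite := by
  have hT : {a : Γ | a ∈ S ∨ a⁻¹ ∈ S}.Finite := by
    refine S.finite_toSet.union ?_
    exact S.finite_toSet.preimage inv_injective.injOn
  have : Finite {a : Γ // a ∈ S ∨ a⁻¹ ∈ S} := hT
  refine ((List.finite_length_le {a : Γ // a ∈ S ∨ a⁻¹ ∈ S} n).image
    fun l => (l.map Subtype.val).prod).subset ?_
  rintro g ⟨l, hl, hmem, rfl⟩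
  lift l to List {a : Γ // a ∈ S ∨ a⁻¹ ∈ S} using hmem
  exact ⟨l, by simpa using hl, rfl⟩

theorem inBall.mul {Γ : Type} [Group Γ] {S : Finset Γ} {m n : ℕ} {g h : Γ}
    (hg : inBall S m g) (hh : inBall S n h) : inBall S (m + n) (g * h) := by
  obtain ⟨l, hl, hlS, rfl⟩ := hg
  obtain ⟨l', hl', hlS', rfl⟩ := hh
  refine ⟨l ++ l', by simp; omega, ?_, by simp⟩
  intro a ha
  rcases List.mem_append.1 ha with h | h
  exacts [hlS a h, hlS' a h]

theorem inBall.inv {Γ : Type} [Group Γ] {S : Finset Γ} {n : ℕ} {g : Γ}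
    (hg : inBall S n g) : inBall S n g⁻¹ := by
  obtain ⟨l, hl, hlS, rfl⟩ := hg
  refine ⟨(l.map (·⁻¹)).reverse, by simpa using hl, ?_, by rw [List.prod_inv_reverse]⟩
  intro a ha
  simp only [List.mem_reverse, List.mem_map] at ha
  obtain ⟨b, hb, rfl⟩ := ha
  simpa using (hlS b hb).symm

theorem inBall.mono {Γ : Type} [Group Γ] {S : Finset Γ} {m n : ℕ} (hmn : m ≤ n) {g : Γ}
    (hg : inBall S m g) : inBall S n g := by
  obtain ⟨l, hl, h⟩ := hg
  exact ⟨l, hl.trans hmn, h⟩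

theorem exists_inBall {Γ : Type} [Group Γ] {S : Finset Γ}
    (hS : Subgroup.closure (S : Set Γ) = ⊤) (g : Γ) : ∃ n, inBall S n g := by
  have hg : g ∈ Subgroup.closure (S : Set Γ) := hS ▸ Subgroup.mem_top g
  induction hg using Subgroup.closure_induction with
  | mem x hx => exact ⟨1, [x], by simp, by simpa using Or.inl hx, by simp⟩
  | one => exact ⟨0, [], by simp, by simp, by simp⟩
  | mul x y _ _ hx hy =>
    obtain ⟨m, hm⟩ := hx
    obtain ⟨n, hn⟩ := hy
    exact ⟨m + n, hm.mul hn⟩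
  | inv x _ hx =>
    obtain ⟨n, hn⟩ := hx
    exact ⟨n, hn.inv⟩

/-- Group homomorphisms are Lipschitz for word metrics. -/
theorem exists_inBall_map {Γ Δ : Type} [Group Γ] [Group Δ] (S : Finset Γ) {T : Finset Δ}
    (hT : Subgroup.closure (T : Set Δ) = ⊤) (f : Γ →* Δ) :
    ∃ C : ℕ, 0 < C ∧ ∀ n g, inBall S n g → inBall T (C * n) (f g) := by
  choose N hN using fun g : Γ => exists_inBall hT (f g)
  have hS : ∀ a, a ∈ S ∨ a⁻¹ ∈ S → inBall T (S.sup N + 1) (f a) := by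
    rintro a (ha | ha)
    · exact (hN a).mono ((Finset.le_sup ha).trans (Nat.le_succ _))
    · simpa using ((hN a⁻¹).mono ((Finset.le_sup ha).trans (Nat.le_succ _))).inv
  have hl : ∀ l : List Γ, (∀ a ∈ l, a ∈ S ∨ a⁻¹ ∈ S) →
      inBall T ((S.sup N + 1) * l.length) (f l.prod) := by
    intro l
    induction l with
    | nil => exact fun _ => ⟨[], by simp, by simp, by simp⟩
    | cons a l ih =>
      intro h
      have := (hS a (h a (by simp))).mul (ih fun b hb => h b (by simp [hb]))
      rw [List.prod_cons, map_mul, List.length_cons]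
      exact this.mono (by rw [mul_add, mul_one, add_comm])
  refine ⟨S.sup N + 1, Nat.succ_pos _, ?_⟩
  rintro n _ ⟨l, hln, hlS, rfl⟩
  exact (hl l hlS).mono (Nat.mul_le_mul_left _ hln)

/-- Free groups are residually finite. -/
theorem FreeGroup.exists_finite_quotient_ne_one {α : Type} {g : FreeGroup α} (hg : g ≠ 1) :
    ∃ (Q : Type) (_ : Group Q) (_ : Fintype Q) (π : FreeGroup α →* Q), π g ≠ 1 := by
  classical
  let X : Set (FreeGroup α) := FreeGroup.mk '' {l | l <:+ g.toWord}
  have hX : X.Finite := by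
    refine Set.Finite.image _ ?_
    simpa only [List.mem_tails] using g.toWord.tails.finite_toSet
  have : Fintype X := hX.fintype
  have hσ : ∀ a : α, ∃ σ : Equiv.Perm X, ∀ w : X, ∀ hw : of a * (w : FreeGroup α) ∈ X,
      σ w = ⟨_, hw⟩ := by
    intro a
    obtain ⟨σ, h⟩ := Equiv.Perm.exists_extending_pair
      (fun w : {w : X // of a * (w : FreeGroup α) ∈ X} => w.1) (fun w => ⟨_, w.2⟩)
      Subtype.val_injective
      (fun v w h => Subtype.ext <| Subtype.ext <| mul_left_cancel <| congrArg Subtype.val h)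
    exact ⟨σ, fun w hw => h ⟨w, hw⟩⟩
  choose σ hσ using hσ
  have key : ∀ l, ∀ hl : l <:+ g.toWord,
      lift σ (mk l) ⟨1, [], List.nil_suffix, rfl⟩ = ⟨mk l, l, hl, rfl⟩ := by
    intro l
    induction l with
    | nil => exact fun _ => rfl
    | cons p l ih =>
      intro hl
      have hl' : l <:+ g.toWord := (List.suffix_cons p l).trans hl
      have hmk : mk (p :: l) = mk [p] * mk l := by simp [mul_mk]
      have hlift : lift σ (mk (p :: l)) = lift σ (mk [p]) * lift σ (mk l) := by
        rw [hmk, _root_.map_mul]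
      rw [hlift, Equiv.Perm.mul_apply, ih hl']
      have hmem : mk (p :: l) ∈ X := ⟨_, hl, rfl⟩
      obtain ⟨a, _ | _⟩ := p
      · have hinv : of a * mk ((a, false) :: l) = mk l := by
          rw [hmk, ← mul_assoc, show mk [(a, false)] = (of a)⁻¹ from rfl, mul_inv_cancel, one_mul]
        have := hσ a ⟨_, hmem⟩ (by rw [hinv]; exact ⟨l, hl', rfl⟩)
        rw [show mk [(a, false)] = (of a)⁻¹ from rfl, _root_.map_inv, lift_apply_of,
          Equiv.Perm.inv_eq_iff_eq, this]
        exact Subtype.ext hinv.symm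
      · rw [show mk [(a, true)] = of a from rfl, lift_apply_of]
        exact hσ a ⟨mk l, _⟩ hmem
  refine ⟨Equiv.Perm X, inferInstance, inferInstance, lift σ, fun h => hg ?_⟩
  have := congrArg Subtype.val (key g.toWord List.suffix_rfl)
  simpa only [mk_toWord, h, Equiv.Perm.one_apply] using this.symm

/-- The action of `ℤ` on `FreeGroup ℤ` by translating the generators. -/
def FreeGroup.shift : Multiplicative ℤ →* MulAut (FreeGroup ℤ) where
  toFun i := freeGroupCongr (Equiv.addRight i.toAdd)
  map_one' := by
    ext x
    simp
  map_mul' i j := by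
    refine MulEquiv.toMonoidHom_injective (FreeGroup.ext_hom _ _ fun x => ?_)
    simp [add_assoc, add_comm j.toAdd]

/-- A free group on at least two generators contains a free group of countable rank:
the conjugates `xⁱ y x⁻ⁱ` are free. -/
theorem FreeGroup.exists_injective_of_ne {α : Type} {x y : α} (hxy : y ≠ x) :
    ∃ f : FreeGroup ℤ →* FreeGroup α, Function.Injective f := by
  classical
  let r : FreeGroup α →* FreeGroup ℤ ⋊[shift] Multiplicative ℤ :=
    lift fun c => if c = x then SemidirectProduct.inr (Multiplicative.ofAdd 1)
      else SemidirectProduct.inl (of 0)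
  let f : FreeGroup ℤ →* FreeGroup α := lift fun i => of x ^ i * of y * (of x ^ i)⁻¹
  have h : r.comp f = SemidirectProduct.inl := by
    refine FreeGroup.ext_hom _ _ fun i => ?_
    have : shift (Multiplicative.ofAdd i) (of 0) = of i := by simp [shift]
    rw [← this, SemidirectProduct.inl_aut, this]
    simp only [MonoidHom.comp_apply, f, r, lift_apply_of, _root_.map_mul, _root_.map_inv,
      map_zpow, if_true, if_neg hxy]
    rw [← map_zpow, ← ofAdd_zsmul, smul_eq_mul, mul_one]
  refine ⟨f, Function.Injective.of_comp (f := r) ?_⟩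
  rw [← MonoidHom.coe_comp, h]
  exact SemidirectProduct.inl_injective

theorem kGamma_le_of_injective {Γ : Type} [Group Γ] {α : Type} {f : Γ →* FreeGroup α}
    (hf : Function.Injective f) {g : Γ} (hg : g ≠ 1) : kGamma g ≤ kGamma (f g) := by
  obtain ⟨Q, hQ, hQ', π, hπ⟩ := FreeGroup.exists_finite_quotient_ne_one
    ((map_ne_one_iff f hf).2 hg)
  obtain ⟨Q, hQ, hQ', π, hπ, hcard⟩ := Nat.sInf_mem (s := {m : ℕ | ∃ (Q : Type) (_ : Group Q)
    (_ : Fintype Q) (π : FreeGroup α →* Q), π (f g) ≠ 1 ∧ Nat.card Q = m})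
    ⟨_, Q, hQ, hQ', π, hπ, rfl⟩
  exact Nat.sInf_le ⟨Q, hQ, hQ', π.comp f, hπ, hcard⟩

theorem kGamma_le_rfGrowth {Γ : Type} [Group Γ] {S : Finset Γ} {n : ℕ} {g : Γ}
    (hg : g ≠ 1) (hgn : inBall S n g) : kGamma g ≤ rfGrowth S n := by
  refine le_csSup (((finite_setOf_inBall S n).image kGamma).subset ?_).bddAbove ⟨g, hg, hgn, rfl⟩
  rintro _ ⟨h, -, hh, rfl⟩
  exact ⟨h, hh, rfl⟩

theorem preceq_rfGrowth_of_injective {Γ : Type} [Group Γ] {α : Type} {f : Γ →* FreeGroup α}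
    (hf : Function.Injective f) (S : Finset Γ) {T : Finset (FreeGroup α)}
    (hT : Subgroup.closure (T : Set (FreeGroup α)) = ⊤) :
    Preceq (fun n => (rfGrowth S n : ℝ)) (fun n => (rfGrowth T n : ℝ)) := by
  obtain ⟨C, hC, h⟩ := exists_inBall_map S hT f
  refine ⟨C, by exact_mod_cast hC, fun n _ => ?_⟩
  have hle : rfGrowth S n ≤ rfGrowth T (C * n) := by
    refine csSup_le' ?_
    rintro _ ⟨g, hg, hgn, rfl⟩
    exact (kGamma_le_of_injective hf hg).trans
      (kGamma_le_rfGrowth ((map_ne_one_iff f hf).2 hg) (h n g hgn))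
  have hceil : ⌈(C : ℝ) * (n : ℝ)⌉₊ = C * n := by
    rw [← Nat.cast_mul, Nat.ceil_natCast]
  simp only [hceil]
  exact_mod_cast hle.trans (Nat.le_mul_of_pos_left _ hC)

theorem preceq_rfGrowth_freeGroup {k l : ℕ} (hl : 2 ≤ l) (S : Finset (FreeGroup (Fin k)))
    {T : Finset (FreeGroup (Fin l))}
    (hT : Subgroup.closure (T : Set (FreeGroup (Fin l))) = ⊤) :
    Preceq (fun n => (rfGrowth S n : ℝ)) (fun n => (rfGrowth T n : ℝ)) := by
  obtain ⟨f, hf⟩ := FreeGroup.exists_injective_of_ne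
    (x := (⟨0, by omega⟩ : Fin l)) (y := ⟨1, by omega⟩) (by simp)
  have hmap : Function.Injective (FreeGroup.map fun i : Fin k => (i : ℤ)) :=
    FreeGroup.map_injective (Nat.cast_injective.comp Fin.val_injective)
  exact preceq_rfGrowth_of_injective (f := f.comp (FreeGroup.map fun i : Fin k => (i : ℤ)))
    (hf.comp hmap) S hT

theorem statement6 (k₁ k₂ : ℕ) (hk₁ : 2 ≤ k₁) (hk₂ : 2 ≤ k₂)
    (S₁ : Finset (FreeGroup (Fin k₁))) (S₂ : Finset (FreeGroup (Fin k₂)))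
    (hS₁ : Subgroup.closure (S₁ : Set (FreeGroup (Fin k₁))) = ⊤)
    (hS₂ : Subgroup.closure (S₂ : Set (FreeGroup (Fin k₂))) = ⊤) :
    Preceq (fun n => (rfGrowth S₁ n : ℝ)) (fun n => (rfGrowth S₂ n : ℝ)) ∧
    Preceq (fun n => (rfGrowth S₂ n : ℝ)) (fun n => (rfGrowth S₁ n : ℝ)) := by
  exact ⟨preceq_rfGrowth_freeGroup hk₂ S₁ hS₂, preceq_rfGrowth_freeGroup hk₁ S₂ hS₁⟩
end

section
/- There exist constants α > 0 and C > 0 such that for every l ≥ 1, the number of pairs (s, t) of sequences of length l with entries in {x, x⁻¹, y, y⁻¹} such that the corresponding products u = s₁⋯s_l and v = t₁⋯t_l commute in the free group F₂ = F(x,y) is at most C · l · e^{−αl} · 16^l. Equivalently, if u_l and v_l are the results of two independent simple random walks of length l on a free generating set of F₂, then P[[u_l, v_l] = 1] ≤ C · l · e^{−αl}. -/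
/-- The four generators `x, x⁻¹, y, y⁻¹` of the free group `F₂ = F(x,y)`,
indexed by a generator index and a sign. -/
def genStep (p : Fin 2 × Bool) : FreeGroup (Fin 2) :=
  if p.2 then FreeGroup.of p.1 else (FreeGroup.of p.1)⁻¹

/-- The product `s₁ ⋯ s_l` in `F₂` corresponding to a sequence of steps. -/
def stepProd {l : ℕ} (s : Fin l → Fin 2 × Bool) : FreeGroup (Fin 2) :=
  (List.ofFn fun i => genStep (s i)).prod

namespace FreeGroup

section CentralizerGrowth

variable {α : Type*} [DecidableEq α]

/-- If there is no cancellation in `g * U` and `g` is at most as long as `U`, then `g` can commute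
with `U` only if it is an initial segment of `U`. -/
theorem toWord_prefix_of_commute {g U : FreeGroup α} (hc : Commute g U) (hlen : g.norm ≤ U.norm)
    (hred : IsReduced (g.toWord ++ U.toWord)) : g.toWord <+: U.toWord := by
  have h₁ : (g * U).toWord = g.toWord ++ U.toWord := by rw [toWord_mul, hred.reduce_eq]
  have h₂ : (g * U).toWord = U.toWord ++ g.toWord := by
    refine (hc.eq ▸ toWord_mul_sublist U g).eq_of_length ?_
    rw [h₁, List.length_append, List.length_append, add_comm]
  exact List.prefix_of_prefix_length_le ⟨_, h₁.symm⟩ ⟨_, h₂.symm⟩ hlen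

/-- An element commuting with a cyclically reduced element `U` and at most as long as `U` is an
initial segment of `U` or of `U⁻¹`. -/
theorem toWord_prefix_or_prefix_inv_of_commute {g U : FreeGroup α} (hc : Commute g U)
    (hlen : g.norm ≤ U.norm) (hU : IsCyclicallyReduced U.toWord) :
    g.toWord <+: U.toWord ∨ g.toWord <+: U⁻¹.toWord := by
  by_cases hred : IsReduced (g.toWord ++ U.toWord)
  · exact .inl (toWord_prefix_of_commute hc hlen hred)
  refine .inr (toWord_prefix_of_commute hc.inv_right (by rwa [norm_inv_eq]) ?_)
  have hg : IsReduced g.toWord := isReduced_toWord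
  have hU' : IsReduced U⁻¹.toWord := isReduced_toWord
  refine List.isChain_append.2 ⟨hg, hU', fun a ha b hb ↦ ?_⟩
  simp only [IsReduced, List.isChain_append, not_and, not_forall] at hred
  obtain ⟨a', ha', c, hcU, h1, h2⟩ := hred hg hU.isReduced
  obtain rfl : a = a' := Option.mem_unique ha ha'
  rw [toWord_inv, invRev, List.head?_reverse, List.getLast?_map] at hb
  obtain ⟨d, hd, rfl⟩ := Option.mem_map.1 hb
  have := hU.2 d hd c hcU
  grind

/-- In the free group, a nontrivial element commutes with only linearly many elements of bounded
length. -/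
theorem exists_finset_of_commute {u : FreeGroup α} (hu : u ≠ 1) {l : ℕ} (hl : u.norm ≤ l) :
    ∃ T : Finset (FreeGroup α), T.card ≤ 2 * (3 * l + 1) ∧
      ∀ g, Commute u g → g.norm ≤ l → g ∈ T := by
  set r := reduceCyclically u.toWord
  set w : FreeGroup α := mk (reduceCyclically.conjugator u.toWord) with hw
  have hdec := reduceCyclically.conj_conjugator_reduceCyclically u.toWord
  have hur : u = w * mk r * w⁻¹ := by
    rw [hw, inv_mk, mul_mk, mul_mk, hdec, mk_toWord]
  have hr0 : r ≠ [] := by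
    intro h
    apply hu
    rw [hur, h, ← one_eq_mk, mul_one, mul_inv_cancel]
  have hwl : w.norm ≤ l := by
    have := congrArg List.length hdec
    simp only [List.length_append] at this
    have h₁ : w.norm ≤ _ := norm_mk_le
    have h₂ : u.toWord.length ≤ l := hl
    omega
  have hcyc : IsCyclicallyReduced (List.replicate (3 * l) r).flatten :=
    (reduceCyclically.isCyclicallyReduced isReduced_toWord).flatten_replicate _
  set U : FreeGroup α := mk (List.replicate (3 * l) r).flatten with hU
  have hUw : U.toWord = (List.replicate (3 * l) r).flatten := by
    rw [hU, toWord_mk, hcyc.isReduced.reduce_eq]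
  have hUpow : U = mk r ^ (3 * l) := by rw [hU, pow_mk]
  have hUn : 3 * l ≤ U.norm := by
    have : 0 < r.length := List.length_pos_iff.2 hr0
    rw [norm, hUw, List.length_flatten, List.map_replicate, List.sum_replicate, smul_eq_mul]
    exact Nat.le_mul_of_pos_right _ this
  refine ⟨((Finset.univ : Finset Bool) ×ˢ Finset.range (3 * l + 1)).image fun p ↦
    w * mk ((cond p.1 U U⁻¹).toWord.take p.2) * w⁻¹, ?_, fun g hg hgl ↦ ?_⟩
  · refine Finset.card_image_le.trans ?_
    simp
  have hcom : Commute (w⁻¹ * g * w) U := by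
    rw [hUpow]
    refine Commute.pow_right ?_ _
    have : mk r = w⁻¹ * u * w := by rw [hur]; group
    rw [this]
    have h : u * g = g * u := hg
    change w⁻¹ * g * w * (w⁻¹ * u * w) = w⁻¹ * u * w * (w⁻¹ * g * w)
    calc _ = w⁻¹ * (g * u) * w := by group
      _ = w⁻¹ * (u * g) * w := by rw [h]
      _ = _ := by group
  have hn : (w⁻¹ * g * w).norm ≤ 3 * l := by
    have h₁ := norm_mul_le (w⁻¹ * g) w
    have h₂ := norm_mul_le w⁻¹ g
    rw [norm_inv_eq] at h₂
    omega
  have key : ∃ b : Bool, (w⁻¹ * g * w).toWord <+: (cond b U U⁻¹).toWord := by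
    rcases toWord_prefix_or_prefix_inv_of_commute hcom (hn.trans hUn) (hUw ▸ hcyc) with h | h
    · exact ⟨true, h⟩
    · exact ⟨false, h⟩
  obtain ⟨b, hb⟩ := key
  refine Finset.mem_image.2 ⟨(b, (w⁻¹ * g * w).norm), by simp; omega, ?_⟩
  have h := List.prefix_iff_eq_take.1 hb
  change w * mk ((cond b U U⁻¹).toWord.take (w⁻¹ * g * w).toWord.length) * w⁻¹ = g
  rw [← h, mk_toWord]
  group

end CentralizerGrowth

end FreeGroup

open FreeGroup hiding norm

theorem genStep_eq_mk (a : Fin 2 × Bool) : genStep a = mk [a] := by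
  obtain ⟨i, b⟩ := a
  cases b <;> rfl

theorem stepProd_cons {l : ℕ} (a : Fin 2 × Bool) (s : Fin l → Fin 2 × Bool) :
    stepProd (Fin.cons a s : Fin (l + 1) → Fin 2 × Bool) = genStep a * stepProd s := by
  simp [stepProd]

theorem norm_stepProd_le {l : ℕ} (s : Fin l → Fin 2 × Bool) : (stepProd s).norm ≤ l := by
  induction l with
  | zero => simp [stepProd]
  | succ l ih =>
    rw [← Fin.cons_self_tail s, stepProd_cons, genStep_eq_mk]
    have h₁ := norm_mul_le (mk [s 0]) (stepProd (Fin.tail s))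
    have h₂ : (mk [s 0]).norm ≤ 1 := norm_mk_le
    have h₃ := ih (Fin.tail s)
    omega

/-- The function `h ↦ 2⁻¹ ^ |h|` is superharmonic up to the factor `7 / 8` for the simple random
walk. -/
theorem sum_half_pow_norm_le (h : FreeGroup (Fin 2)) :
    ∑ a, (1 / 2 : ℝ) ^ (genStep a * h).norm ≤ 7 / 2 * (1 / 2 : ℝ) ^ h.norm := by
  have hword (a : Fin 2 × Bool) : (genStep a * h).norm = (reduce (a :: h.toWord)).length := by
    rw [genStep_eq_mk, FreeGroup.norm, toWord_mul, toWord_mk, reduce_singleton, List.singleton_append]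
  simp only [hword, reduce.cons, reduce_toWord]
  rw [FreeGroup.norm]
  rcases h.toWord with _ | ⟨⟨i, b⟩, L⟩
  · norm_num [Fintype.sum_prod_type]
  · have hL : (0 : ℝ) < (1 / 2) ^ L.length := by positivity
    fin_cases i <;> cases b <;> simp [Fintype.sum_prod_type, pow_succ] <;> linarith

theorem sum_half_pow_norm_stepProd_mul_le (l : ℕ) (h : FreeGroup (Fin 2)) :
    ∑ s : Fin l → Fin 2 × Bool, (1 / 2 : ℝ) ^ (stepProd s * h).norm ≤
      (7 / 2) ^ l * (1 / 2 : ℝ) ^ h.norm := by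
  induction l with
  | zero => simp [stepProd]
  | succ l ih =>
    rw [← (Fin.consEquiv fun _ ↦ Fin 2 × Bool).sum_comp, Fintype.sum_prod_type_right]
    calc _ = ∑ s : Fin l → Fin 2 × Bool, ∑ a, (1 / 2 : ℝ) ^ (genStep a * (stepProd s * h)).norm := by
          simp only [← mul_assoc, ← stepProd_cons]
          rfl
      _ ≤ ∑ s : Fin l → Fin 2 × Bool, 7 / 2 * (1 / 2 : ℝ) ^ (stepProd s * h).norm :=
          Finset.sum_le_sum fun s _ ↦ sum_half_pow_norm_le (stepProd s * h)
      _ ≤ _ := by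
          rw [← Finset.mul_sum, pow_succ]
          linarith

/-- Every element of the free group is hit by at most `(7 / 2) ^ l` step sequences of length `l`. -/
theorem card_stepProd_eq_le (l : ℕ) (g : FreeGroup (Fin 2)) :
    (Finset.card {s : Fin l → Fin 2 × Bool | stepProd s = g} : ℝ) ≤ (7 / 2) ^ l := by
  calc (Finset.card {s : Fin l → Fin 2 × Bool | stepProd s = g} : ℝ)
      = ∑ s : Fin l → Fin 2 × Bool, if stepProd s = g then (1 : ℝ) else 0 := by simp
    _ ≤ ∑ s : Fin l → Fin 2 × Bool, (1 / 2 : ℝ) ^ (stepProd s * g⁻¹).norm := by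
        refine Finset.sum_le_sum fun s _ ↦ ?_
        split_ifs with h
        · simp [h]
        · positivity
    _ ≤ (7 / 2) ^ l * (1 / 2 : ℝ) ^ (g⁻¹).norm := sum_half_pow_norm_stepProd_mul_le l g⁻¹
    _ ≤ (7 / 2) ^ l := mul_le_of_le_one_right (by positivity)
        (pow_le_one₀ (by norm_num) (by norm_num))

theorem card_commute_stepProd_le {l : ℕ} {u : FreeGroup (Fin 2)} (hu : u ≠ 1) (hl : u.norm ≤ l) :
    (Finset.card {t : Fin l → Fin 2 × Bool | u * stepProd t = stepProd t * u} : ℝ) ≤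
      2 * (3 * l + 1) * (7 / 2) ^ l := by
  obtain ⟨T, hT, hmem⟩ := exists_finset_of_commute hu hl
  have hsub : ({t : Fin l → Fin 2 × Bool | u * stepProd t = stepProd t * u} : Finset _) ⊆
      T.biUnion fun g ↦ {t | stepProd t = g} := by
    intro t ht
    simpa using hmem _ (Finset.mem_filter.1 ht).2 (norm_stepProd_le t)
  calc _ ≤ ((T.biUnion fun g ↦ {t : Fin l → Fin 2 × Bool | stepProd t = g}).card : ℝ) :=
        mod_cast Finset.card_le_card hsub
    _ ≤ ∑ g ∈ T, (Finset.card {t : Fin l → Fin 2 × Bool | stepProd t = g} : ℝ) :=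
        mod_cast Finset.card_biUnion_le
    _ ≤ T.card * (7 / 2 : ℝ) ^ l := by
        simpa using Finset.sum_le_sum fun g (_ : g ∈ T) ↦ card_stepProd_eq_le l g
    _ ≤ _ := by
        gcongr
        exact_mod_cast hT

theorem card_commute_pairs_le (l : ℕ) :
    (Nat.card {p : (Fin l → Fin 2 × Bool) × (Fin l → Fin 2 × Bool) //
        Commute (stepProd p.1) (stepProd p.2)} : ℝ) ≤ (6 * l + 3) * 14 ^ l := by
  have hcard : (Fintype.card (Fin l → Fin 2 × Bool) : ℝ) = 4 ^ l := by simp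
  have h14 : (4 : ℝ) ^ l * (7 / 2) ^ l = 14 ^ l := by rw [← mul_pow]; norm_num
  have hpt (s : Fin l → Fin 2 × Bool) :
      (Finset.card {t : Fin l → Fin 2 × Bool |
        stepProd s * stepProd t = stepProd t * stepProd s} : ℝ) ≤
      (if stepProd s = 1 then (4 : ℝ) ^ l else 0) + 2 * (3 * l + 1) * (7 / 2) ^ l := by
    split_ifs with h
    · refine le_add_of_le_of_nonneg ?_ (by positivity)
      rw [← hcard]
      exact_mod_cast Finset.card_le_univ _
    · rw [zero_add]
      exact card_commute_stepProd_le h (norm_stepProd_le s)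
  calc _ = ∑ s : Fin l → Fin 2 × Bool, (Finset.card {t : Fin l → Fin 2 × Bool |
        stepProd s * stepProd t = stepProd t * stepProd s} : ℝ) := by
        simp only [commute_iff_eq]
        rw [Nat.card_eq_fintype_card, Fintype.card_subtype, Finset.card_filter,
          Fintype.sum_prod_type]
        simp only [Finset.card_filter, Nat.cast_sum]
    _ ≤ ∑ s : Fin l → Fin 2 × Bool,
        ((if stepProd s = 1 then (4 : ℝ) ^ l else 0) + 2 * (3 * l + 1) * (7 / 2) ^ l) :=
        Finset.sum_le_sum fun s _ ↦ hpt s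
    _ = Finset.card {s : Fin l → Fin 2 × Bool | stepProd s = 1} * 4 ^ l +
        2 * (3 * l + 1) * 14 ^ l := by
        rw [Finset.sum_add_distrib, ← Finset.sum_filter, Finset.sum_const, Finset.sum_const,
          nsmul_eq_mul, nsmul_eq_mul, Finset.card_univ, hcard, ← h14]
        ring
    _ ≤ (7 / 2) ^ l * 4 ^ l + 2 * (3 * l + 1) * 14 ^ l := by
        gcongr
        exact card_stepProd_eq_le l 1
    _ = _ := by rw [mul_comm ((7 / 2 : ℝ) ^ l), h14]; ring

theorem statement15 :
    ∃ α C : ℝ, 0 < α ∧ 0 < C ∧ ∀ l : ℕ, 1 ≤ l →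
      (Nat.card {p : (Fin l → Fin 2 × Bool) × (Fin l → Fin 2 × Bool) //
          Commute (stepProd p.1) (stepProd p.2)} : ℝ) ≤
        C * l * Real.exp (-α * l) * 16 ^ l := by
  refine ⟨Real.log (8 / 7), 9, Real.log_pos (by norm_num), by norm_num, fun l hl ↦ ?_⟩
  have hexp : Real.exp (-Real.log (8 / 7) * l) = (7 / 8) ^ l := by
    rw [← Real.log_inv, mul_comm, Real.exp_nat_mul, Real.exp_log (by norm_num)]
    norm_num
  have hl' : (1 : ℝ) ≤ l := by exact_mod_cast hl
  rw [hexp, mul_assoc, ← mul_pow, show (7 / 8 * 16 : ℝ) = 14 by norm_num]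
  refine (card_commute_pairs_le l).trans ?_
  gcongr
  linarith
end

section
/- In the free group F(a,b) on two generators a, b, the element w̃ = [[a,b],[b,a⁻¹]], where [u,v] = u⁻¹v⁻¹uv, is a nontrivial element of the second derived subgroup F(a,b)'' and has word length 14 as a reduced word. -/
/-- The commutator convention `[u,v] = u⁻¹v⁻¹uv`. -/
def commutator' {G : Type*} [Group G] (u v : G) : G := u⁻¹ * v⁻¹ * u * v

/-- The free group on the two generators `a`, `b`. -/
local notation "a" => FreeGroup.of (0 : Fin 2)
local notation "b" => FreeGroup.of (1 : Fin 2)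

open scoped commutatorElement in
theorem commutator'_eq_commutatorElement {G : Type*} [Group G] (u v : G) :
    commutator' u v = ⁅u⁻¹, v⁻¹⁆ := by
  simp [commutator', commutatorElement_def]

theorem commutator'_mem_derivedSeries_succ {G : Type*} [Group G] {n : ℕ} {u v : G}
    (hu : u ∈ derivedSeries G n) (hv : v ∈ derivedSeries G n) :
    commutator' u v ∈ derivedSeries G (n + 1) := by
  rw [commutator'_eq_commutatorElement, derivedSeries_succ]
  exact Subgroup.commutator_mem_commutator (inv_mem hu) (inv_mem hv)

theorem statement17 :
    commutator' (commutator' a b) (commutator' b a⁻¹) ≠ 1 ∧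
    commutator' (commutator' a b) (commutator' b a⁻¹) ∈ derivedSeries (FreeGroup (Fin 2)) 2 ∧
    (commutator' (commutator' a b) (commutator' b a⁻¹)).toWord.length = 14 := by
  have hlen : (commutator' (commutator' a b) (commutator' b a⁻¹)).toWord.length = 14 := by
    decide
  refine ⟨fun h => ?_, ?_, hlen⟩
  · simp [h] at hlen
  · have h (u v : FreeGroup (Fin 2)) : commutator' u v ∈ derivedSeries (FreeGroup (Fin 2)) 1 :=
      commutator'_mem_derivedSeries_succ (Subgroup.mem_top u) (Subgroup.mem_top v)
    exact commutator'_mem_derivedSeries_succ (h _ _) (h _ _)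
end
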